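/- Let d, N, T ≥ 1, L > 0, λ ≥ max(1, L²), α ≥ 0, and let w : Fin N → ℝ be non-negative and non-increasing with w_max = max_i w i. Let θ⋆ ∈ ℝ^d, and for each round t ∈ Fin T and agent n ∈ Fin N let m_{t,n} ∈ ℝ^d with ‖m_{t,n}‖₂ ≤ L. Let n_t ∈ Fin N be the agent chosen at round t, write x_t = m_{t,n_t}, and define M_t = λ I_d + ∑_{s<t} x_s x_sᵀ. Let θ̂_t ∈ ℝ^d satisfy ‖θ̂_t − θ⋆‖_{M_t} ≤ α for all t ∈ Fin T. Define the true utilities f_t(n) = ⟨m_{t,n}, θ⋆⟩, assumed nonnegative, and the UCB utilities u_t(n) = ⟨m_{t,n}, θ̂_t⟩ + α · ‖m_{t,n}‖_{M_t⁻¹}. Let U_t : Fin N → ℝ be arbitrary cumulative-utility vectors, suppose n_t maximizes n ↦ G_w(update U_t n (U_t n + u_t(n))) and n⋆_t maximizes n ↦ G_w(update U_t n (U_t n + f_t(n))). Then the cumulative regret satisfies ∑_{t=0}^{T−1} [ G_w(update U_t n⋆_t (U_t n⋆_t + f_t(n⋆_t))) − G_w(update U_t n_t (U_t n_t + f_t(n_t)))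 ] ≤ 2 · α · w_max · √( 2 · d · T · log(1 + T·L²/(λ·d)) ). -/

import Mathlib

open Finset Matrix

/-- The weighted Gini social-evaluation function: `G_w(U) = ∑ i, w i * Φ_i(U)`,
where `Φ_i(U)` is the `(i+1)`-th smallest entry of `U`. -/
noncomputable def gini {N : ℕ} (w U : Fin N → ℝ) : ℝ :=
  ∑ i, w i * U (Tuple.sort U i)

/-- The `M`-weighted norm `‖x‖_M = √(xᵀ M x)`. -/
noncomputable def wnorm {d : ℕ} (M : Matrix (Fin d) (Fin d) ℝ) (x : Fin d → ℝ) : ℝ :=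
  Real.sqrt (x ⬝ᵥ M.mulVec x)

theorem gini_le_sum_perm {N : ℕ} {w : Fin N → ℝ} (hw : Antitone w) (U : Fin N → ℝ)
    (σ : Equiv.Perm (Fin N)) : gini w U ≤ ∑ i, w i * U (σ i) := by
  have hanti : Antivary w (U ∘ Tuple.sort U) := by
    intro i j hij
    exact hw ((Tuple.monotone_sort U).reflect_lt hij).le
  have h := hanti.sum_mul_le_sum_mul_comp_perm (σ := σ.trans (Tuple.sort U).symm)
  simpa [gini] using h

theorem gini_mono {N : ℕ} {w : Fin N → ℝ} (hw0 : ∀ i, 0 ≤ w i) (hw : Antitone w)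
    {U V : Fin N → ℝ} (h : U ≤ V) : gini w U ≤ gini w V :=
  (gini_le_sum_perm hw U (Tuple.sort V)).trans
    (Finset.sum_le_sum fun i _ => mul_le_mul_of_nonneg_left (h _) (hw0 i))

theorem gini_update_le {N : ℕ} {w : Fin N → ℝ} (hw : Antitone w) {c : ℝ} (hc : ∀ i, w i ≤ c)
    (U : Fin N → ℝ) (n : Fin N) {a b : ℝ} (hab : b ≤ a) :
    gini w (Function.update U n a) ≤ gini w (Function.update U n b) + c * (a - b) := by
  set σ := Tuple.sort (Function.update U n b) with hσ
  have hterm : ∀ i, w i * Function.update U n a (σ i) =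
      w i * Function.update U n b (σ i) + if i = σ.symm n then w i * (a - b) else 0 := by
    intro i
    by_cases hi : σ i = n
    · have : i = σ.symm n := by rw [← hi]; simp
      rw [if_pos this, hi]
      simp only [Function.update_self]
      ring
    · have : i ≠ σ.symm n := by rintro rfl; simp at hi
      simp [hi, this]
  have h := gini_le_sum_perm hw (Function.update U n a) σ
  rw [Finset.sum_congr rfl fun i _ => hterm i, Finset.sum_add_distrib,
    Finset.sum_ite_eq' Finset.univ] at h
  simp only [Finset.mem_univ, if_true] at h
  have h2 := mul_le_mul_of_nonneg_right (hc (σ.symm n)) (sub_nonneg.2 hab)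
  have h3 : gini w (Function.update U n b) = ∑ i, w i * Function.update U n b (σ i) := rfl
  linarith

theorem wnorm_nonneg {d : ℕ} (M : Matrix (Fin d) (Fin d) ℝ) (x : Fin d → ℝ) : 0 ≤ wnorm M x :=
  Real.sqrt_nonneg _

theorem Matrix.PosDef.mulVec_inv_mulVec {d : ℕ} {M : Matrix (Fin d) (Fin d) ℝ} (hM : M.PosDef)
    (x : Fin d → ℝ) : M.mulVec (M⁻¹.mulVec x) = x := by
  rw [Matrix.mulVec_mulVec, Matrix.mul_nonsing_inv _ (isUnit_iff_ne_zero.2 hM.det_pos.ne'),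
    Matrix.one_mulVec]

theorem Matrix.PosDef.dotProduct_mulVec_comm {d : ℕ} {M : Matrix (Fin d) (Fin d) ℝ}
    (hM : M.PosDef) (x y : Fin d → ℝ) : x ⬝ᵥ M.mulVec y = y ⬝ᵥ M.mulVec x := by
  have h : Mᵀ = M := by simpa [Matrix.IsHermitian] using hM.isHermitian
  rw [Matrix.dotProduct_mulVec, dotProduct_comm, ← Matrix.mulVec_transpose, h]

theorem Matrix.PosDef.dotProduct_mulVec_self_nonneg {d : ℕ} {M : Matrix (Fin d) (Fin d) ℝ}
    (hM : M.PosDef) (x : Fin d → ℝ) : 0 ≤ x ⬝ᵥ M.mulVec x := by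
  simpa using hM.posSemidef.dotProduct_mulVec_nonneg x

theorem wnorm_sq {d : ℕ} {M : Matrix (Fin d) (Fin d) ℝ} (hM : M.PosDef) (x : Fin d → ℝ) :
    wnorm M x ^ 2 = x ⬝ᵥ M.mulVec x :=
  Real.sq_sqrt (hM.dotProduct_mulVec_self_nonneg x)

/-- Cauchy-Schwarz for the dual norms `‖·‖_{M⁻¹}` and `‖·‖_M`. -/
theorem abs_dotProduct_le_wnorm_inv_mul_wnorm {d : ℕ} {M : Matrix (Fin d) (Fin d) ℝ}
    (hM : M.PosDef) (x v : Fin d → ℝ) : |x ⬝ᵥ v| ≤ wnorm M⁻¹ x * wnorm M v := by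
  have hquad : ∀ r : ℝ, 0 ≤ (x ⬝ᵥ M⁻¹.mulVec x) * (r * r) + (2 * (x ⬝ᵥ v)) * r
      + v ⬝ᵥ M.mulVec v := by
    intro r
    have h := hM.dotProduct_mulVec_self_nonneg (r • M⁻¹.mulVec x + v)
    rw [Matrix.mulVec_add, Matrix.mulVec_smul, hM.mulVec_inv_mulVec, dotProduct_add,
      add_dotProduct, add_dotProduct, smul_dotProduct, smul_dotProduct, dotProduct_smul,
      dotProduct_smul, hM.dotProduct_mulVec_comm (M⁻¹.mulVec x) v, hM.mulVec_inv_mulVec,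
      dotProduct_comm _ x, dotProduct_comm v x] at h
    simp only [smul_eq_mul] at h
    linarith
  have hd := discrim_le_zero hquad
  rw [discrim] at hd
  apply abs_le_of_sq_le_sq _ (mul_nonneg (wnorm_nonneg _ _) (wnorm_nonneg _ _))
  rw [mul_pow, wnorm_sq hM.inv, wnorm_sq hM]
  linarith

theorem wnorm_inv_sq_le {d : ℕ} {S : Matrix (Fin d) (Fin d) ℝ} (hS : S.PosSemidef) {lam : ℝ}
    (hlam : 0 < lam) (hM : (lam • (1 : Matrix (Fin d) (Fin d) ℝ) + S).PosDef) (x : Fin d → ℝ) :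
    wnorm (lam • (1 : Matrix (Fin d) (Fin d) ℝ) + S)⁻¹ x ^ 2 ≤ x ⬝ᵥ x / lam := by
  rw [wnorm_sq hM.inv]
  set M := lam • (1 : Matrix (Fin d) (Fin d) ℝ) + S with hMdef
  set y := M⁻¹.mulVec x with hy
  have h1 : lam * (y ⬝ᵥ y) ≤ x ⬝ᵥ y := by
    have h := hM.mulVec_inv_mulVec x
    rw [← hy] at h
    have h0 : 0 ≤ y ⬝ᵥ S.mulVec y := by simpa using hS.dotProduct_mulVec_nonneg y
    rw [dotProduct_comm x, ← h, hMdef, Matrix.add_mulVec, Matrix.smul_mulVec, Matrix.one_mulVec,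
      dotProduct_add, dotProduct_smul, smul_eq_mul]
    linarith
  have h2 : 0 ≤ (x - lam • y) ⬝ᵥ (x - lam • y) := by
    simpa using dotProduct_star_self_nonneg (x - lam • y)
  simp only [sub_dotProduct, dotProduct_sub, smul_dotProduct, dotProduct_smul, smul_eq_mul,
    dotProduct_comm y x] at h2
  rw [le_div_iff₀ hlam]
  nlinarith

theorem Matrix.PosDef.log_det_le {d : ℕ} (hd : 1 ≤ d) {A : Matrix (Fin d) (Fin d) ℝ}
    (hA : A.PosDef) : Real.log A.det ≤ d * Real.log (A.trace / d) := by
  have hd0 : (0 : ℝ) < d := by exact_mod_cast hd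
  have : Nonempty (Fin d) := ⟨⟨0, hd⟩⟩
  have hpos := hA.eigenvalues_pos
  have htr : A.trace = ∑ i, hA.isHermitian.eigenvalues i := by
    simpa using hA.isHermitian.trace_eq_sum_eigenvalues
  have hdet : A.det = ∏ i, hA.isHermitian.eigenvalues i := by
    simpa using hA.isHermitian.det_eq_prod_eigenvalues
  have htr0 : 0 < A.trace := by
    rw [htr]
    exact Finset.sum_pos (fun i _ => hpos i) Finset.univ_nonempty
  have hc : 0 < A.trace / d := div_pos htr0 hd0
  rw [hdet, Real.log_prod fun i _ => (hpos i).ne']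
  have hterm : ∀ i, Real.log (hA.isHermitian.eigenvalues i) ≤
      Real.log (A.trace / d) + (hA.isHermitian.eigenvalues i / (A.trace / d) - 1) := by
    intro i
    have h := Real.log_le_sub_one_of_pos (div_pos (hpos i) hc)
    rw [Real.log_div (hpos i).ne' hc.ne'] at h
    linarith
  refine (Finset.sum_le_sum fun i _ => hterm i).trans (le_of_eq ?_)
  rw [Finset.sum_add_distrib, Finset.sum_sub_distrib, ← Finset.sum_div, ← htr]
  simp only [Finset.sum_const, Finset.card_univ, Fintype.card_fin, nsmul_eq_mul, mul_one]
  field_simp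
  ring

theorem Matrix.PosDef.log_det_add_vecMulVec {d : ℕ} {A : Matrix (Fin d) (Fin d) ℝ}
    (hA : A.PosDef) (x : Fin d → ℝ) :
    Real.log (A + Matrix.vecMulVec x x).det =
      Real.log A.det + Real.log (1 + wnorm A⁻¹ x ^ 2) := by
  have hne := hA.det_pos.ne'
  have hq : 0 < 1 + wnorm A⁻¹ x ^ 2 := by positivity
  have hdet : (1 + Matrix.replicateRow Unit x * A⁻¹ * Matrix.replicateCol Unit x).det =
      1 + wnorm A⁻¹ x ^ 2 := by
    rw [wnorm_sq hA.inv, Matrix.det_unique, Matrix.mul_assoc, ← Matrix.replicateCol_mulVec,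
      Matrix.add_apply, Matrix.one_apply_eq, Matrix.replicateRow_mul_replicateCol_apply]
  rw [Matrix.vecMulVec_eq Unit,
    Matrix.det_add_replicateCol_mul_replicateRow (isUnit_iff_ne_zero.2 hne), hdet,
    Real.log_mul hne hq.ne']

/-- The regularized design matrix `λ I + ∑_{s<k} x_s x_sᵀ`. -/
noncomputable def designMatrix {d : ℕ} (lam : ℝ) (x : ℕ → Fin d → ℝ) (k : ℕ) :
    Matrix (Fin d) (Fin d) ℝ :=
  lam • (1 : Matrix (Fin d) (Fin d) ℝ) + ∑ s ∈ Finset.range k, Matrix.vecMulVec (x s) (x s)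

theorem posSemidef_sum_vecMulVec {d : ℕ} (x : ℕ → Fin d → ℝ) (k : ℕ) :
    (∑ s ∈ Finset.range k, Matrix.vecMulVec (x s) (x s)).PosSemidef :=
  Matrix.posSemidef_sum _ fun s _ => by
    simpa using Matrix.posSemidef_vecMulVec_self_star (x s)

theorem designMatrix_posDef {d : ℕ} {lam : ℝ} (hlam : 0 < lam) (x : ℕ → Fin d → ℝ) (k : ℕ) :
    (designMatrix lam x k).PosDef :=
  (Matrix.PosDef.one.smul hlam).add_posSemidef (posSemidef_sum_vecMulVec x k)

theorem log_det_designMatrix {d : ℕ} {lam : ℝ} (hlam : 0 < lam) (x : ℕ → Fin d → ℝ) (k : ℕ) :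
    Real.log (designMatrix lam x k).det = d * Real.log lam +
      ∑ s ∈ Finset.range k, Real.log (1 + wnorm (designMatrix lam x s)⁻¹ (x s) ^ 2) := by
  induction k with
  | zero => simp [designMatrix]
  | succ k ih =>
    have h : designMatrix lam x (k + 1) =
        designMatrix lam x k + Matrix.vecMulVec (x k) (x k) := by
      simp [designMatrix, Finset.sum_range_succ, add_assoc]
    rw [h, (designMatrix_posDef hlam x k).log_det_add_vecMulVec, ih, Finset.sum_range_succ,
      add_assoc]

/-- The elliptical potential lemma. -/
theorem sum_wnorm_inv_sq_le {d : ℕ} (hd : 1 ≤ d) {lam L : ℝ} (hlam : 0 < lam)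
    (hL : L ^ 2 ≤ lam) (x : ℕ → Fin d → ℝ) (hx : ∀ s, x s ⬝ᵥ x s ≤ L ^ 2) (k : ℕ) :
    ∑ s ∈ Finset.range k, wnorm (designMatrix lam x s)⁻¹ (x s) ^ 2 ≤
      2 * d * Real.log (1 + k * L ^ 2 / (lam * d)) := by
  have hd0 : (0 : ℝ) < d := by exact_mod_cast hd
  have hstep : ∀ s, wnorm (designMatrix lam x s)⁻¹ (x s) ^ 2 ≤
      2 * Real.log (1 + wnorm (designMatrix lam x s)⁻¹ (x s) ^ 2) := by
    intro s
    have h0 := sq_nonneg (wnorm (designMatrix lam x s)⁻¹ (x s))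
    have h1 : wnorm (designMatrix lam x s)⁻¹ (x s) ^ 2 ≤ 1 :=
      (wnorm_inv_sq_le (posSemidef_sum_vecMulVec x s) hlam (designMatrix_posDef hlam x s)
        (x s)).trans ((div_le_one hlam).2 ((hx s).trans hL))
    generalize wnorm (designMatrix lam x s)⁻¹ (x s) ^ 2 = q at h0 h1 ⊢
    have h2 := Real.le_log_one_add_of_nonneg h0
    have h3 : q / 2 ≤ 2 * q / (q + 2) := by
      rw [div_le_div_iff₀ (by norm_num) (by linarith)]
      nlinarith
    linarith
  have htr : (designMatrix lam x k).trace ≤ lam * d + k * L ^ 2 := by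
    rw [designMatrix, Matrix.trace_add, Matrix.trace_smul, Matrix.trace_one, Matrix.trace_sum]
    simp only [Matrix.trace_vecMulVec, Fintype.card_fin, smul_eq_mul]
    have := Finset.sum_le_card_nsmul (Finset.range k) (fun s => x s ⬝ᵥ x s) (L ^ 2)
      fun s _ => hx s
    simp only [Finset.card_range, nsmul_eq_mul] at this
    linarith
  have hpd := designMatrix_posDef hlam x k
  have : Nonempty (Fin d) := ⟨⟨0, hd⟩⟩
  have hlog : Real.log ((designMatrix lam x k).trace / d) ≤
      Real.log lam + Real.log (1 + k * L ^ 2 / (lam * d)) := by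
    rw [← Real.log_mul hlam.ne' (by positivity)]
    apply Real.log_le_log (div_pos hpd.trace_pos hd0)
    rw [div_le_iff₀ hd0]
    refine htr.trans (le_of_eq ?_)
    field_simp
  have h1 := hpd.log_det_le hd
  rw [log_det_designMatrix hlam] at h1
  have h2 := mul_le_mul_of_nonneg_left hlog hd0.le
  calc _ ≤ ∑ s ∈ Finset.range k, 2 * Real.log (1 + wnorm (designMatrix lam x s)⁻¹ (x s) ^ 2) :=
        Finset.sum_le_sum fun s _ => hstep s
    _ ≤ _ := by
        rw [← Finset.mul_sum]
        linarith

theorem stmt_9 (d N T : ℕ) (hd : 1 ≤ d) (hN : 1 ≤ N) (hT : 1 ≤ T)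
    (lam L alpha : ℝ) (hL : 0 < L) (hlam : max 1 (L ^ 2) ≤ lam) (halpha : 0 ≤ alpha)
    (w : Fin N → ℝ) (hw_nonneg : ∀ i, 0 ≤ w i) (hw_anti : Antitone w)
    (wmax : ℝ) (hwmax : wmax = Finset.univ.sup' ⟨⟨0, hN⟩, Finset.mem_univ _⟩ w)
    (thetaStar : Fin d → ℝ)
    (m : Fin T → Fin N → Fin d → ℝ)
    (hm : ∀ t n, Real.sqrt (∑ i, (m t n i) ^ 2) ≤ L)
    (nt : Fin T → Fin N)
    (x : Fin T → Fin d → ℝ) (hx : ∀ t, x t = m t (nt t))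
    (M : Fin T → Matrix (Fin d) (Fin d) ℝ)
    (hM : ∀ t, M t = lam • (1 : Matrix (Fin d) (Fin d) ℝ) +
      ∑ s ∈ Finset.univ.filter (fun s => s < t), Matrix.vecMulVec (x s) (x s))
    (thetaHat : Fin T → Fin d → ℝ)
    (hconf : ∀ t, wnorm (M t) (thetaHat t - thetaStar) ≤ alpha)
    (f : Fin T → Fin N → ℝ) (hf : ∀ t n, f t n = m t n ⬝ᵥ thetaStar)
    (hfpos : ∀ t n, 0 ≤ f t n)
    (u : Fin T → Fin N → ℝ)
    (hu : ∀ t n, u t n = m t n ⬝ᵥ thetaHat t + alpha * wnorm (M t)⁻¹ (m t n))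
    (U : Fin T → Fin N → ℝ)
    (nstar : Fin T → Fin N)
    (hnt : ∀ t n, gini w (Function.update (U t) n (U t n + u t n)) ≤
      gini w (Function.update (U t) (nt t) (U t (nt t) + u t (nt t))))
    (hstar : ∀ t n, gini w (Function.update (U t) n (U t n + f t n)) ≤
      gini w (Function.update (U t) (nstar t) (U t (nstar t) + f t (nstar t)))) :
    ∑ t, (gini w (Function.update (U t) (nstar t) (U t (nstar t) + f t (nstar t))) -
        gini w (Function.update (U t) (nt t) (U t (nt t) + f t (nt t)))) ≤
      2 * alpha * wmax * Real.sqrt (2 * d * T * Real.log (1 + T * L ^ 2 / (lam * d))) := by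
  have hlam0 : 0 < lam := lt_of_lt_of_le one_pos ((le_max_left _ _).trans hlam)
  have hLlam : L ^ 2 ≤ lam := (le_max_right _ _).trans hlam
  have hwc : ∀ i, w i ≤ wmax := fun i => hwmax ▸ Finset.le_sup' w (Finset.mem_univ i)
  have hwmax0 : 0 ≤ wmax := (hw_nonneg ⟨0, hN⟩).trans (hwc _)
  let y : ℕ → Fin d → ℝ := fun k => if h : k < T then x ⟨k, h⟩ else 0
  have hyx : ∀ t : Fin T, y t = x t := fun t => dif_pos t.2
  have hMy : ∀ t : Fin T, M t = designMatrix lam y t := by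
    intro t
    rw [hM, designMatrix]
    congr 1
    refine Finset.sum_bij (fun s _ => (s : ℕ)) ?_ ?_ ?_ ?_
    · intro s hs
      simpa using hs
    · intro a _ b _ h
      exact Fin.ext h
    · intro b hb
      have hb' := Finset.mem_range.1 hb
      exact ⟨⟨b, hb'.trans t.2⟩, Finset.mem_filter.2 ⟨Finset.mem_univ _, hb'⟩, rfl⟩
    · intro s _
      rw [hyx]
  have hpd : ∀ t, (M t).PosDef := fun t => hMy t ▸ designMatrix_posDef hlam0 y t
  have hmsq : ∀ t n, m t n ⬝ᵥ m t n ≤ L ^ 2 := by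
    intro t n
    have h := (Real.sqrt_le_left hL.le).1 (hm t n)
    simpa [dotProduct, sq] using h
  have hysq : ∀ s, y s ⬝ᵥ y s ≤ L ^ 2 := by
    intro s
    by_cases h : s < T
    · rw [show y s = m ⟨s, h⟩ (nt ⟨s, h⟩) from (hyx ⟨s, h⟩).trans (hx _)]
      exact hmsq _ _
    · simpa [y, h] using sq_nonneg L
  have herr : ∀ t n, |u t n - alpha * wnorm (M t)⁻¹ (m t n) - f t n| ≤
      alpha * wnorm (M t)⁻¹ (m t n) := by
    intro t n
    have h := abs_dotProduct_le_wnorm_inv_mul_wnorm (hpd t) (m t n) (thetaHat t - thetaStar)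
    have h' := mul_le_mul_of_nonneg_left (hconf t) (wnorm_nonneg (M t)⁻¹ (m t n))
    rw [dotProduct_sub] at h
    rw [hu, hf, add_sub_cancel_right, mul_comm alpha]
    exact h.trans h'
  have hfu : ∀ t n, f t n ≤ u t n := fun t n => by
    have := (abs_le.1 (herr t n)).1
    linarith
  have huf : ∀ t n, u t n - f t n ≤ 2 * alpha * wnorm (M t)⁻¹ (m t n) := fun t n => by
    have := (abs_le.1 (herr t n)).2
    linarith
  have hstep : ∀ t, gini w (Function.update (U t) (nstar t) (U t (nstar t) + f t (nstar t))) -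
      gini w (Function.update (U t) (nt t) (U t (nt t) + f t (nt t))) ≤
      2 * alpha * wmax * wnorm (M t)⁻¹ (x t) := by
    intro t
    have h1 : gini w (Function.update (U t) (nstar t) (U t (nstar t) + f t (nstar t))) ≤
        gini w (Function.update (U t) (nstar t) (U t (nstar t) + u t (nstar t))) :=
      gini_mono hw_nonneg hw_anti
        (update_le_update_iff.2 ⟨by linarith [hfu t (nstar t)], fun _ _ => le_rfl⟩)
    have h2 := hnt t (nstar t)
    have h3 := gini_update_le hw_anti hwc (U t) (nt t)
      (add_le_add_right (hfu t (nt t)) (U t (nt t)))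
    have h4 := mul_le_mul_of_nonneg_left (huf t (nt t)) hwmax0
    rw [hx]
    rw [add_sub_add_left_eq_sub] at h3
    linarith
  refine (Finset.sum_le_sum fun t _ => hstep t).trans ?_
  rw [← Finset.mul_sum]
  refine mul_le_mul_of_nonneg_left ?_ (by positivity)
  apply Real.le_sqrt_of_sq_le
  have hcs := sq_sum_le_card_mul_sum_sq (s := Finset.univ)
    (f := fun t => wnorm (M t)⁻¹ (x t))
  have hpot := sum_wnorm_inv_sq_le hd hlam0 hLlam y hysq T
  rw [Finset.card_univ, Fintype.card_fin] at hcs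
  rw [← Fin.sum_univ_eq_sum_range
    (fun s => wnorm (designMatrix lam y s)⁻¹ (y s) ^ 2)] at hpot
  simp only [← hMy, hyx] at hpot
  have := mul_le_mul_of_nonneg_left hpot (Nat.cast_nonneg (α := ℝ) T)
  linarith
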